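/- Let C ≠ C_{n,d} be a d-uniform clutter on [n] and I = I(C̄) its circuit ideal. If F ∈ C is the only circuit of C containing a given submaximal circuit e, then reg(I) = reg(I + (x_F)). -/

import Mathlib

open MvPolynomial

noncomputable section

/-- A graded free resolution of the ideal `I` over the polynomial ring `K[xᵢ : i ∈ σ]`:
the `i`-th free module has rank `b i`, its `k`-th standard generator sits in degree
`deg i k`; `aug` is the augmentation map onto `I` and `d i` are the differentials.
All maps are graded (matrix entries are homogeneous of the appropriate degrees) and the
complex is exact. -/
def IsGradedFreeResolution {sig K : Type*} [Field K]
    (I : Ideal (MvPolynomial sig K)) (b : ℕ → ℕ) (deg : (i : ℕ) → Fin (b i) → ℕ)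
    (aug : (Fin (b 0) → MvPolynomial sig K) →ₗ[MvPolynomial sig K] MvPolynomial sig K)
    (d : (i : ℕ) → ((Fin (b (i + 1)) → MvPolynomial sig K) →ₗ[MvPolynomial sig K]
      (Fin (b i) → MvPolynomial sig K))) : Prop :=
  LinearMap.range aug = I ∧
  (∀ k, (aug (Pi.single k 1)).IsHomogeneous (deg 0 k)) ∧
  (∀ i k l, (d i) (Pi.single k 1) l = 0 ∨
    ∃ e, deg i l + e = deg (i + 1) k ∧ ((d i) (Pi.single k 1) l).IsHomogeneous e) ∧
  LinearMap.ker aug = LinearMap.range (d 0) ∧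
  (∀ i, LinearMap.ker (d i) = LinearMap.range (d (i + 1)))

/-- `I` has a `q`-linear resolution: `I` has a graded free resolution in which the `i`-th
free module is generated entirely in degree `q + i`.  (Equivalently, `I` is generated in
degree `q` and `β_{i,j}(I) = 0` whenever `j ≠ i + q`.) -/
def HasLinearResolution {sig K : Type*} [Field K] (q : ℕ)
    (I : Ideal (MvPolynomial sig K)) : Prop :=
  ∃ b deg aug d, IsGradedFreeResolution I b deg aug d ∧ ∀ i k, deg i k = q + i

/-- The Castelnuovo–Mumford regularity of `I`: the least `r` admitting a graded free
resolution of `I` whose `i`-th free module is generated in degrees `≤ r + i`.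
(Equivalently, `reg I = sup { j - i : β_{i,j}(I) ≠ 0 }`.) -/
noncomputable def idealReg {sig K : Type*} [Field K] (I : Ideal (MvPolynomial sig K)) : ℕ :=
  sInf {r : ℕ | ∃ b deg aug d, IsGradedFreeResolution I b deg aug d ∧ ∀ i k, deg i k ≤ r + i}

/-- The circuit ideal of a clutter `C` on `[n]`: the ideal generated by the square-free
monomials `x_F = ∏_{i ∈ F} x_i` for the circuits `F ∈ C`. -/
noncomputable def circuitIdeal {n : ℕ} (K : Type*) [Field K]
    (C : Finset (Finset (Fin n))) : Ideal (MvPolynomial (Fin n) K) :=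
  Ideal.span ((fun F => ∏ i ∈ F, (MvPolynomial.X i : MvPolynomial (Fin n) K)) '' ↑C)

/-- The complement of a `d`-uniform clutter `C` on `[n]` inside the maximal `d`-uniform
clutter `C_{n,d}` of all `d`-subsets of `[n]`. -/
def clutterCompl {n : ℕ} (d : ℕ) (C : Finset (Finset (Fin n))) : Finset (Finset (Fin n)) :=
  Finset.powersetCard d (Finset.univ : Finset (Fin n)) \ C


section GradedRegularity

universe u v

variable {K : Type v} {S M N P : Type u} [CommRing K] [CommRing S] [Algebra K S]
  [AddCommGroup M] [Module S M] [AddCommGroup N] [Module S N] [AddCommGroup P] [Module S P]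

/-- The grading of the free module `ι → S` whose `i`-th standard generator sits in degree
`w i`. -/
def freeGrading (𝒜 : ℕ → Submodule K S) {ι : Type} (w : ι → ℕ) (m : ℕ) :
    AddSubgroup (ι → S) where
  carrier := {x | ∀ i, x i = 0 ∨ ∃ e, w i + e = m ∧ x i ∈ 𝒜 e}
  zero_mem' _ := Or.inl rfl
  add_mem' {x y} hx hy i := by
    rcases hx i with h | ⟨a, ha, h⟩
    · simpa [h] using hy i
    · rcases hy i with h' | ⟨b, hb, h'⟩
      · exact Or.inr ⟨a, ha, by simpa [h'] using h⟩
      · obtain rfl : a = b := by omega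
        exact Or.inr ⟨a, ha, add_mem h h'⟩
  neg_mem' {x} hx i := by
    rcases hx i with h | ⟨a, ha, h⟩
    · exact Or.inl (by simp [h])
    · exact Or.inr ⟨a, ha, neg_mem h⟩

/-- The grading induced on a submodule. -/
def subGrading (ℳ : ℕ → AddSubgroup M) (L : Submodule S M) (m : ℕ) : AddSubgroup L :=
  (ℳ m).comap L.subtype.toAddMonoidHom

/-- The grading of a direct sum. -/
def prodGrading (ℳ : ℕ → AddSubgroup M) (𝒩 : ℕ → AddSubgroup N) (m : ℕ) :
    AddSubgroup (M × N) :=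
  (ℳ m).prod (𝒩 m)

/-- A linear map that is surjective, both globally and in every degree. -/
structure IsGradedSurjection (ℳ : ℕ → AddSubgroup M) (𝒩 : ℕ → AddSubgroup N)
    (g : M →ₗ[S] N) : Prop where
  surjective : Function.Surjective g
  map_mem : ∀ {m x}, x ∈ ℳ m → g x ∈ 𝒩 m
  exists_preimage : ∀ {m y}, y ∈ 𝒩 m → ∃ x ∈ ℳ m, g x = y

/-- A short exact sequence of graded modules, exact in every degree. -/
structure IsGradedShortExact (ℳ : ℕ → AddSubgroup M) (𝒩 : ℕ → AddSubgroup N)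
    (𝒬 : ℕ → AddSubgroup P) (f : M →ₗ[S] N) (g : N →ₗ[S] P) : Prop where
  injective : Function.Injective f
  exact : ∀ y, g y = 0 ↔ ∃ x, f x = y
  mem_iff : ∀ {m x}, f x ∈ 𝒩 m ↔ x ∈ ℳ m
  graded : IsGradedSurjection 𝒩 𝒬 g

/-- The graded module `M` has the first `k` steps of a graded free resolution by finitely
generated free modules, the `i`-th of them generated in degrees at most `r + i`. -/
def HasBoundedResolution (𝒜 : ℕ → Submodule K S) :
    ℕ → ℕ → ∀ {M : Type u} [AddCommGroup M] [Module S M], (ℕ → AddSubgroup M) → Prop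
  | 0, _, _, _, _, _ => True
  | k + 1, r, _, _, _, ℳ => ∃ (ι : Type) (_ : Fintype ι) (w : ι → ℕ) (p : (ι → S) →ₗ[S] _),
      (∀ i, w i ≤ r) ∧ IsGradedSurjection (freeGrading 𝒜 w) ℳ p ∧
        HasBoundedResolution 𝒜 k (r + 1) (subGrading (freeGrading 𝒜 w) (LinearMap.ker p))

variable {𝒜 : ℕ → Submodule K S} {ℳ : ℕ → AddSubgroup M} {𝒩 : ℕ → AddSubgroup N}
  {𝒬 : ℕ → AddSubgroup P} {ι κ : Type} {w : ι → ℕ} {w' : κ → ℕ} {k r m : ℕ}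

@[simp]
theorem mem_subGrading {L : Submodule S M} {x : L} :
    x ∈ subGrading ℳ L m ↔ (x : M) ∈ ℳ m := Iff.rfl

@[simp]
theorem mem_prodGrading {x : M × N} :
    x ∈ prodGrading ℳ 𝒩 m ↔ x.1 ∈ ℳ m ∧ x.2 ∈ 𝒩 m := Iff.rfl

theorem mem_freeGrading {x : ι → S} :
    x ∈ freeGrading 𝒜 w m ↔ ∀ i, x i = 0 ∨ ∃ e, w i + e = m ∧ x i ∈ 𝒜 e := Iff.rfl

theorem mem_freeGrading_sumElim {x : ι ⊕ κ → S} :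
    x ∈ freeGrading 𝒜 (Sum.elim w w') m ↔
      x ∘ Sum.inl ∈ freeGrading 𝒜 w m ∧ x ∘ Sum.inr ∈ freeGrading 𝒜 w' m := by
  simp [mem_freeGrading]

instance [SetLike.GradedMul 𝒜] : SetLike.GradedSMul 𝒜 (freeGrading 𝒜 w) where
  smul_mem {i j a x} ha hx l := by
    rcases hx l with h | ⟨e, he, h⟩
    · exact Or.inl (by simp [h])
    · exact Or.inr ⟨i + e, by simp only [vadd_eq_add]; omega, SetLike.mul_mem_graded ha h⟩

instance [SetLike.GradedSMul 𝒜 ℳ] (L : Submodule S M) :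
    SetLike.GradedSMul 𝒜 (subGrading ℳ L) where
  smul_mem {_ _ _ _} ha hx := SetLike.GradedSMul.smul_mem (B := ℳ) ha hx

instance [SetLike.GradedSMul 𝒜 ℳ] [SetLike.GradedSMul 𝒜 𝒩] :
    SetLike.GradedSMul 𝒜 (prodGrading ℳ 𝒩) where
  smul_mem {_ _ _ _} ha hx := ⟨SetLike.GradedSMul.smul_mem (B := ℳ) ha hx.1,
    SetLike.GradedSMul.smul_mem (B := 𝒩) ha hx.2⟩

theorem single_mem_freeGrading [DecidableEq ι] {i : ι} {e : ℕ} {s : S} (hs : s ∈ 𝒜 e)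
    (h : w i + e = m) : Pi.single i s ∈ freeGrading 𝒜 w m := by
  intro j
  by_cases hj : j = i
  · subst hj
    exact Or.inr ⟨e, h, by simpa using hs⟩
  · exact Or.inl (by simp [hj])

theorem single_one_mem_freeGrading [SetLike.GradedOne 𝒜] [DecidableEq ι] (w : ι → ℕ) (i : ι) :
    Pi.single i (1 : S) ∈ freeGrading 𝒜 w (w i) :=
  single_mem_freeGrading SetLike.GradedOne.one_mem rfl

/-- A linear map out of a graded free module is graded as soon as it is so on generators. -/
theorem map_mem_of_mem_freeGrading [Fintype ι] [DecidableEq ι] [SetLike.GradedSMul 𝒜 ℳ]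
    (h : (ι → S) →ₗ[S] M) (hh : ∀ i, h (Pi.single i 1) ∈ ℳ (w i)) {x : ι → S}
    (hx : x ∈ freeGrading 𝒜 w m) : h x ∈ ℳ m := by
  rw [LinearMap.pi_apply_eq_sum_univ]
  refine sum_mem fun i _ => ?_
  have h1 : h (fun j => if i = j then 1 else 0) ∈ ℳ (w i) := by
    convert hh i using 2
    ext j
    simp [Pi.single_apply, eq_comm]
  rcases hx i with h0 | ⟨e, he, h2⟩
  · simp [h0]
  · have := SetLike.GradedSMul.smul_mem (B := ℳ) h2 h1
    rwa [vadd_eq_add, add_comm, he] at this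

/-- Graded free modules are projective with respect to graded surjections. -/
theorem IsGradedSurjection.exists_lift [Fintype ι] [SetLike.GradedOne 𝒜]
    [SetLike.GradedSMul 𝒜 ℳ] {g : M →ₗ[S] N} (hg : IsGradedSurjection ℳ 𝒩 g)
    (h : (ι → S) →ₗ[S] N) (hh : ∀ {m x}, x ∈ freeGrading 𝒜 w m → h x ∈ 𝒩 m) :
    ∃ l : (ι → S) →ₗ[S] M, (∀ x, g (l x) = h x) ∧
      ∀ {m x}, x ∈ freeGrading 𝒜 w m → l x ∈ ℳ m := by
  classical
  choose b hb hgb using fun i => hg.exists_preimage (hh (single_one_mem_freeGrading w i))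
  refine ⟨Fintype.linearCombination S b, fun x => ?_, fun {m x} hx =>
    map_mem_of_mem_freeGrading _ (fun i => ?_) hx⟩
  · have : g ∘ₗ Fintype.linearCombination S b = h := by
      refine LinearMap.pi_ext' fun i => LinearMap.ext_ring ?_
      simp [hgb]
    exact LinearMap.congr_fun this x
  · simpa using hb i

theorem HasBoundedResolution.of_equiv (e : M ≃ₗ[S] N)
    (he : ∀ {m x}, e x ∈ 𝒩 m ↔ x ∈ ℳ m) (h : HasBoundedResolution 𝒜 k r ℳ) :
    HasBoundedResolution 𝒜 k r 𝒩 := by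
  cases k with
  | zero => trivial
  | succ k =>
    obtain ⟨ι, _, w, p, hw, hp, hk⟩ := h
    refine ⟨ι, inferInstance, w, e.toLinearMap ∘ₗ p, hw, ⟨e.surjective.comp hp.surjective,
      fun hx => he.2 (hp.map_mem hx), fun {m y} hy => ?_⟩, ?_⟩
    · obtain ⟨x, hx, hxy⟩ := hp.exists_preimage (y := e.symm y) (he.1 (by simpa using hy))
      exact ⟨x, hx, by simp [hxy]⟩
    · rwa [LinearEquiv.ker_comp]

theorem IsGradedShortExact.hasBoundedResolution_ker_iff {f : M →ₗ[S] N} {g : N →ₗ[S] P}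
    (h : IsGradedShortExact ℳ 𝒩 𝒬 f g) :
    HasBoundedResolution 𝒜 k r (subGrading 𝒩 (LinearMap.ker g)) ↔
      HasBoundedResolution 𝒜 k r ℳ := by
  have hf (x : M) : f x ∈ LinearMap.ker g := (h.exact _).2 ⟨x, rfl⟩
  let e : M ≃ₗ[S] LinearMap.ker g := LinearEquiv.ofBijective (f.codRestrict _ hf)
    ⟨fun x y hxy => h.injective (congrArg Subtype.val hxy), fun y => by
      obtain ⟨x, hx⟩ := (h.exact _).1 y.2
      exact ⟨x, Subtype.ext hx⟩⟩
  have he {m x} : e x ∈ subGrading 𝒩 (LinearMap.ker g) m ↔ x ∈ ℳ m := h.mem_iff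
  exact ⟨.of_equiv e.symm fun {m x} => by simpa using (he (x := e.symm x)).symm, .of_equiv e he⟩

theorem hasBoundedResolution_of_subsingleton [Subsingleton M] :
    HasBoundedResolution 𝒜 k r ℳ := by
  induction k generalizing r M with
  | zero => trivial
  | succ k ih =>
    refine ⟨Empty, inferInstance, fun _ => 0, 0, fun _ => Nat.zero_le _,
      ⟨fun y => ⟨0, Subsingleton.elim _ _⟩, fun _ => zero_mem _,
        fun _ => ⟨0, zero_mem _, Subsingleton.elim _ _⟩⟩, ih⟩

theorem hasBoundedResolution_freeGrading [Fintype ι] (hw : ∀ i, w i ≤ r) :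
    HasBoundedResolution 𝒜 k r (freeGrading 𝒜 w) := by
  cases k with
  | zero => trivial
  | succ k =>
    have : Subsingleton (LinearMap.ker (LinearMap.id : (ι → S) →ₗ[S] _)) := by
      rw [LinearMap.ker_id]; infer_instance
    exact ⟨ι, inferInstance, w, LinearMap.id, hw, ⟨Function.surjective_id, id, fun h => ⟨_, h, rfl⟩⟩,
      hasBoundedResolution_of_subsingleton⟩

/-- The horseshoe lemma for bounded resolutions. -/
theorem IsGradedShortExact.hasBoundedResolution_middle [SetLike.GradedMonoid 𝒜]
    [SetLike.GradedSMul 𝒜 𝒩]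
    {f : M →ₗ[S] N} {g : N →ₗ[S] P} (h : IsGradedShortExact ℳ 𝒩 𝒬 f g)
    (hM : HasBoundedResolution 𝒜 k r ℳ) (hP : HasBoundedResolution 𝒜 k r 𝒬) :
    HasBoundedResolution 𝒜 k r 𝒩 := by
  induction k generalizing r M N P with
  | zero => trivial
  | succ k ih =>
    obtain ⟨ι, _, w, p, hw, hp, hpk⟩ := hM
    obtain ⟨κ, _, w', q, hw', hq, hqk⟩ := hP
    obtain ⟨l, hl, hlm⟩ := h.graded.exists_lift q hq.map_mem
    let t : (ι ⊕ κ → S) →ₗ[S] N := f ∘ₗ p ∘ₗ LinearMap.funLeft S S Sum.inl +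
      l ∘ₗ LinearMap.funLeft S S Sum.inr
    have ht (x) : t x = f (p (x ∘ Sum.inl)) + l (x ∘ Sum.inr) := rfl
    have hgf (x) : g (f x) = 0 := (h.exact _).2 ⟨x, rfl⟩
    have hgt (x) : g (t x) = q (x ∘ Sum.inr) := by simp [ht, hgf, hl]
    refine ⟨ι ⊕ κ, inferInstance, Sum.elim w w', t, by simpa using ⟨hw, hw'⟩,
      ⟨fun y => ?_, fun {m x} hx => ?_, fun {m y} hy => ?_⟩, ?_⟩
    · obtain ⟨b, hb⟩ := hq.surjective (g y)
      obtain ⟨z, hz⟩ := (h.exact (y - l b)).1 (by simp [hl, hb])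
      obtain ⟨a, rfl⟩ := hp.surjective z
      exact ⟨Sum.elim a b, by simp [ht, hz]⟩
    · rw [mem_freeGrading_sumElim] at hx
      exact add_mem (h.mem_iff.2 (hp.map_mem hx.1)) (hlm hx.2)
    · obtain ⟨b, hbm, hb⟩ := hq.exists_preimage (h.graded.map_mem hy)
      obtain ⟨z, hz⟩ := (h.exact (y - l b)).1 (by simp [hl, hb])
      have hzm : z ∈ ℳ m := h.mem_iff.1 (hz ▸ sub_mem hy (hlm hbm))
      obtain ⟨a, ham, rfl⟩ := hp.exists_preimage hzm
      exact ⟨Sum.elim a b, by simpa [mem_freeGrading_sumElim] using ⟨ham, hbm⟩,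
        by simp [ht, hz]⟩
    · let i : (ι → S) →ₗ[S] (ι ⊕ κ → S) :=
        { toFun := fun a => Sum.elim a (0 : κ → S)
          map_add' := fun a b => by ext (j | j) <;> simp
          map_smul' := fun a b => by ext (j | j) <;> simp }
      have hi (a) : i a = Sum.elim a 0 := rfl
      let F : LinearMap.ker p →ₗ[S] LinearMap.ker t :=
        (i ∘ₗ (LinearMap.ker p).subtype).codRestrict _ fun a => by
          simp [ht, hi, LinearMap.mem_ker.1 a.2]
      let G : LinearMap.ker t →ₗ[S] LinearMap.ker q :=
        (LinearMap.funLeft S S Sum.inr ∘ₗ (LinearMap.ker t).subtype).codRestrict _ fun a => by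
          have := hgt a
          rw [LinearMap.mem_ker.1 a.2, map_zero] at this
          exact this.symm
      have hF (a) : (F a : ι ⊕ κ → S) = Sum.elim (a : ι → S) 0 := rfl
      have hG (a) : (G a : κ → S) = (a : ι ⊕ κ → S) ∘ Sum.inr := rfl
      refine ih (f := F) (g := G) ⟨fun a b hab => ?_, fun y => ⟨fun hy => ?_, ?_⟩,
        fun {m x} => ?_, ⟨fun y => ?_, fun {m x} hx => ?_, fun {m y} hy => ?_⟩⟩ hpk hqk
      · have := congrArg Subtype.val hab
        rw [hF, hF] at this
        exact Subtype.ext (by simpa using congrArg (· ∘ Sum.inl) this)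
      · have hy' : (y : ι ⊕ κ → S) ∘ Sum.inr = 0 := by rw [← hG, hy]; rfl
        have hty : t y = 0 := y.2
        refine ⟨⟨(y : ι ⊕ κ → S) ∘ Sum.inl, h.injective ?_⟩, Subtype.ext ?_⟩
        · simpa [ht, hy'] using hty
        · rw [hF]
          ext (j | j)
          · rfl
          · exact (congrFun hy' j).symm
      · rintro ⟨x, rfl⟩
        exact Subtype.ext (by rw [hG, hF]; rfl)
      · simp [hF, mem_freeGrading_sumElim]
      · have hy : g (-l y) = 0 := by simp [hl, LinearMap.mem_ker.1 y.2]
        obtain ⟨z, hz⟩ := (h.exact _).1 hy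
        obtain ⟨a, rfl⟩ := hp.surjective z
        exact ⟨⟨Sum.elim a y, by simp [ht, hz]⟩, Subtype.ext (by rw [hG]; rfl)⟩
      · exact (mem_freeGrading_sumElim.1 hx).2
      · have hy0 : g (-l y) = 0 := by simp [hl, LinearMap.mem_ker.1 y.2]
        obtain ⟨z, hz⟩ := (h.exact _).1 hy0
        have hzm : z ∈ ℳ m := h.mem_iff.1 (hz ▸ neg_mem (hlm hy))
        obtain ⟨a, ham, rfl⟩ := hp.exists_preimage hzm
        exact ⟨⟨Sum.elim a y, by simp [ht, hz]⟩,
          mem_freeGrading_sumElim.2 ⟨by simpa using ham, by simpa using hy⟩,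
          Subtype.ext (by rw [hG]; rfl)⟩

theorem HasBoundedResolution.prod [SetLike.GradedMonoid 𝒜] [SetLike.GradedSMul 𝒜 ℳ]
    [SetLike.GradedSMul 𝒜 𝒩] (hM : HasBoundedResolution 𝒜 k r ℳ)
    (hN : HasBoundedResolution 𝒜 k r 𝒩) :
    HasBoundedResolution 𝒜 k r (prodGrading ℳ 𝒩) := by
  refine IsGradedShortExact.hasBoundedResolution_middle (f := LinearMap.inl S M N)
    (g := LinearMap.snd S M N) ⟨LinearMap.inl_injective, fun y => ⟨fun hy => ⟨y.1, ?_⟩, ?_⟩, ?_,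
      LinearMap.snd_surjective, fun hx => hx.2, fun {m y} hy => ⟨(0, y), ⟨zero_mem _, hy⟩, rfl⟩⟩
      hM hN
  · exact Prod.ext rfl hy.symm
  · rintro ⟨x, rfl⟩
    rfl
  · simp

/-- If the middle term and the kernel of a graded short exact sequence have bounded
resolutions, then so does the quotient. -/
theorem IsGradedShortExact.hasBoundedResolution_right [SetLike.GradedMonoid 𝒜]
    {f : M →ₗ[S] N} {g : N →ₗ[S] P} (h : IsGradedShortExact ℳ 𝒩 𝒬 f g)
    (hM : HasBoundedResolution 𝒜 k (r + 1) ℳ) (hN : HasBoundedResolution 𝒜 (k + 1) r 𝒩) :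
    HasBoundedResolution 𝒜 (k + 1) r 𝒬 := by
  obtain ⟨ι, _, w, p, hw, hp, hpk⟩ := hN
  refine ⟨ι, inferInstance, w, g ∘ₗ p, hw, ⟨h.graded.surjective.comp hp.surjective,
    fun hx => h.graded.map_mem (hp.map_mem hx), fun {m y} hy => ?_⟩, ?_⟩
  · obtain ⟨z, hzm, rfl⟩ := h.graded.exists_preimage hy
    obtain ⟨x, hxm, rfl⟩ := hp.exists_preimage hzm
    exact ⟨x, hxm, rfl⟩
  · have hle : LinearMap.ker p ≤ LinearMap.ker (g ∘ₗ p) := LinearMap.ker_le_ker_comp p g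
    let G : LinearMap.ker (g ∘ₗ p) →ₗ[S] LinearMap.ker g :=
      (p ∘ₗ (LinearMap.ker (g ∘ₗ p)).subtype).codRestrict _ fun x => x.2
    have hG (x) : (G x : N) = p x := rfl
    refine IsGradedShortExact.hasBoundedResolution_middle (f := Submodule.inclusion hle) (g := G)
      ⟨Submodule.inclusion_injective hle, fun y => ⟨fun hy => ?_, ?_⟩, Iff.rfl,
        fun y => ?_, fun hx => hp.map_mem hx, fun {m y} hy => ?_⟩ hpk
      (h.hasBoundedResolution_ker_iff.2 hM)
    · exact ⟨⟨y, congrArg Subtype.val hy⟩, rfl⟩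
    · rintro ⟨x, rfl⟩
      exact Subtype.ext x.2
    · obtain ⟨x, hx⟩ := hp.surjective y
      exact ⟨⟨x, by simp [hx]⟩, Subtype.ext hx⟩
    · obtain ⟨x, hxm, hx⟩ := hp.exists_preimage hy
      exact ⟨⟨x, by simp [hx]⟩, hxm, Subtype.ext hx⟩

/-- Schanuel's lemma: the kernels of two graded surjections from free modules onto the same
module are isomorphic up to free summands. -/
theorem IsGradedSurjection.hasBoundedResolution_ker_prod [SetLike.GradedMonoid 𝒜] [Fintype ι]
    [Fintype κ] {p : (ι → S) →ₗ[S] M} {q : (κ → S) →ₗ[S] M}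
    (hp : IsGradedSurjection (freeGrading 𝒜 w) ℳ p)
    (hq : IsGradedSurjection (freeGrading 𝒜 w') ℳ q) (hw : ∀ i, w i ≤ r)
    (hqk : HasBoundedResolution 𝒜 k r (subGrading (freeGrading 𝒜 w') (LinearMap.ker q))) :
    HasBoundedResolution 𝒜 k r
      (prodGrading (subGrading (freeGrading 𝒜 w) (LinearMap.ker p)) (freeGrading 𝒜 w')) := by
  obtain ⟨l, hl, hlm⟩ := hp.exists_lift q hq.map_mem
  let F : LinearMap.ker q →ₗ[S] LinearMap.ker p × (κ → S) :=
    LinearMap.prod (-(l ∘ₗ (LinearMap.ker q).subtype).codRestrict _ fun x => by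
      simp [hl, LinearMap.mem_ker.1 x.2]) (LinearMap.ker q).subtype
  have hF1 (x) : ((F x).1 : ι → S) = -l x := rfl
  have hF2 (x) : (F x).2 = x := rfl
  let G : LinearMap.ker p × (κ → S) →ₗ[S] (ι → S) :=
    LinearMap.coprod (LinearMap.ker p).subtype l
  have hG (x) : G x = x.1 + l x.2 := rfl
  refine IsGradedShortExact.hasBoundedResolution_middle (f := F) (g := G)
    ⟨fun x y hxy => Subtype.ext (congrArg Prod.snd hxy), fun y => ⟨fun hy => ?_, ?_⟩,
      fun {m x} => ⟨fun hx => hx.2, fun hx => ⟨?_, hx⟩⟩, fun x => ?_, fun {m x} hx => ?_,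
      fun {m x} hx => ?_⟩ hqk (hasBoundedResolution_freeGrading hw)
  · rw [hG] at hy
    refine ⟨⟨y.2, ?_⟩, Prod.ext (Subtype.ext ?_) rfl⟩
    · have := congrArg p hy
      simpa [hl, LinearMap.mem_ker.1 y.1.2] using this
    · rw [hF1]
      exact (eq_neg_of_add_eq_zero_left hy).symm
  · rintro ⟨x, rfl⟩
    simp [hG, hF1, hF2]
  · exact (neg_mem (hlm hx) : -l x ∈ freeGrading 𝒜 w m)
  · obtain ⟨y, hy⟩ := hq.surjective (p x)
    exact ⟨(⟨x - l y, by simp [hl, hy]⟩, y), by simp [hG]⟩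
  · exact add_mem hx.1 (hlm hx.2)
  · obtain ⟨y, hym, hy⟩ := hq.exists_preimage (hp.map_mem hx)
    exact ⟨(⟨x - l y, by simp [hl, hy]⟩, y), ⟨sub_mem hx (hlm hym), hym⟩, by simp [hG]⟩

/-- Direct summands inherit bounded resolutions. -/
theorem HasBoundedResolution.fst [SetLike.GradedMonoid 𝒜]
    (h : HasBoundedResolution 𝒜 k r (prodGrading ℳ 𝒩)) : HasBoundedResolution 𝒜 k r ℳ := by
  induction k generalizing r M N with
  | zero => trivial
  | succ k ih =>
    obtain ⟨ι, _, w, q, hw, hq, hqk⟩ := h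
    have hp1 : IsGradedSurjection (freeGrading 𝒜 w) ℳ (LinearMap.fst S M N ∘ₗ q) := by
      refine ⟨Prod.fst_surjective.comp hq.surjective, fun hx => (hq.map_mem hx).1,
        fun {m y} hy => ?_⟩
      obtain ⟨x, hxm, hx⟩ := hq.exists_preimage (m := m) (y := (y, 0)) ⟨hy, zero_mem _⟩
      exact ⟨x, hxm, by simp [hx]⟩
    have hp2 : IsGradedSurjection (freeGrading 𝒜 w) 𝒩 (LinearMap.snd S M N ∘ₗ q) := by
      refine ⟨Prod.snd_surjective.comp hq.surjective, fun hx => (hq.map_mem hx).2,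
        fun {m y} hy => ?_⟩
      obtain ⟨x, hxm, hx⟩ := hq.exists_preimage (m := m) (y := (0, y)) ⟨zero_mem _, hy⟩
      exact ⟨x, hxm, by simp [hx]⟩
    refine ⟨ι, inferInstance, w, _, hw, hp1, ?_⟩
    set p1 := LinearMap.fst S M N ∘ₗ q
    set p2 := LinearMap.snd S M N ∘ₗ q
    let t : (ι ⊕ ι → S) →ₗ[S] M × N :=
      (p1 ∘ₗ LinearMap.funLeft S S Sum.inl).prod (p2 ∘ₗ LinearMap.funLeft S S Sum.inr)
    have ht1 (x) : (t x).1 = p1 (x ∘ Sum.inl) := rfl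
    have ht2 (x) : (t x).2 = p2 (x ∘ Sum.inr) := rfl
    have ht : IsGradedSurjection (freeGrading 𝒜 (Sum.elim w w)) (prodGrading ℳ 𝒩) t := by
      refine ⟨fun y => ?_, fun {m x} hx => ?_, fun {m y} hy => ?_⟩
      · obtain ⟨a, ha⟩ := hp1.surjective y.1
        obtain ⟨b, hb⟩ := hp2.surjective y.2
        exact ⟨Sum.elim a b, Prod.ext ha hb⟩
      · rw [mem_freeGrading_sumElim] at hx
        exact ⟨hp1.map_mem hx.1, hp2.map_mem hx.2⟩
      · obtain ⟨a, ham, ha⟩ := hp1.exists_preimage hy.1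
        obtain ⟨b, hbm, hb⟩ := hp2.exists_preimage hy.2
        exact ⟨Sum.elim a b, mem_freeGrading_sumElim.2 ⟨ham, hbm⟩, Prod.ext ha hb⟩
    have key := (ht.hasBoundedResolution_ker_prod hq (r := r + 1)
      (by simpa using fun i => (hw i).trans r.le_succ) hqk)
    let e : LinearMap.ker t ≃ₗ[S] LinearMap.ker p1 × LinearMap.ker p2 :=
      { toFun := fun x => (⟨(x : ι ⊕ ι → S) ∘ Sum.inl, congrArg Prod.fst x.2⟩,
          ⟨(x : ι ⊕ ι → S) ∘ Sum.inr, congrArg Prod.snd x.2⟩)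
        invFun := fun y => ⟨Sum.elim y.1 y.2, Prod.ext y.1.2 y.2.2⟩
        map_add' := fun _ _ => rfl
        map_smul' := fun _ _ => rfl
        left_inv := fun x => Subtype.ext (Sum.elim_comp_inl_inr _)
        right_inv := fun _ => rfl }
    have he {m x} : e x ∈ prodGrading (subGrading (freeGrading 𝒜 w) (LinearMap.ker p1))
        (subGrading (freeGrading 𝒜 w) (LinearMap.ker p2)) m ↔
        x ∈ subGrading (freeGrading 𝒜 (Sum.elim w w)) (LinearMap.ker t) m :=
      mem_freeGrading_sumElim.symm
    exact ih (ih key |>.of_equiv e he)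

/-- The kernel of any graded surjection from a bounded free module is controlled. -/
theorem IsGradedSurjection.hasBoundedResolution_ker [SetLike.GradedMonoid 𝒜] [Fintype ι]
    {p : (ι → S) →ₗ[S] M} (hp : IsGradedSurjection (freeGrading 𝒜 w) ℳ p)
    (hw : ∀ i, w i ≤ r) (h : HasBoundedResolution 𝒜 (k + 1) r ℳ) :
    HasBoundedResolution 𝒜 k (r + 1) (subGrading (freeGrading 𝒜 w) (LinearMap.ker p)) := by
  obtain ⟨κ, _, w', q, -, hq, hqk⟩ := h
  exact (hp.hasBoundedResolution_ker_prod hq (fun i => (hw i).trans r.le_succ) hqk).fst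

end GradedRegularity

section GradedIdeals

universe u v

variable {K : Type v} {S M : Type u} [CommRing K] [CommRing S] [Algebra K S]
  [AddCommGroup M] [Module S M]

/-- The grading of an ideal of a graded ring. -/
def idealGrading (𝒜 : ℕ → Submodule K S) (I : Ideal S) : ℕ → AddSubgroup I :=
  subGrading (fun m => (𝒜 m).toAddSubgroup) I

/-- Every degree of the grading is the image of an additive map vanishing on the other degrees
and restricting to the identity. -/
def HasProjections (ℳ : ℕ → AddSubgroup M) : Prop :=
  ∀ m, ∃ π : M →+ M, (∀ x ∈ ℳ m, π x = x) ∧ ∀ j x, j ≠ m → x ∈ ℳ j → π x = 0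

variable {𝒜 : ℕ → Submodule K S} {ℳ : ℕ → AddSubgroup M} {ι : Type} {w : ι → ℕ} {k r m : ℕ}

@[simp]
theorem mem_idealGrading {I : Ideal S} {x : I} : x ∈ idealGrading 𝒜 I m ↔ (x : S) ∈ 𝒜 m :=
  Iff.rfl

instance [SetLike.GradedMul 𝒜] :
    SetLike.GradedSMul 𝒜 (fun m => (𝒜 m).toAddSubgroup) where
  smul_mem {_ _ _ _} ha hx := SetLike.mul_mem_graded (A := 𝒜) ha hx

instance [SetLike.GradedMul 𝒜] (I : Ideal S) : SetLike.GradedSMul 𝒜 (idealGrading 𝒜 I) :=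
  inferInstanceAs (SetLike.GradedSMul 𝒜 (subGrading (fun m => (𝒜 m).toAddSubgroup) I))

theorem hasProjections_toAddSubgroup [GradedAlgebra 𝒜] :
    HasProjections fun m => (𝒜 m).toAddSubgroup :=
  fun m => ⟨GradedRing.proj 𝒜 m, fun _ hx => DirectSum.decompose_of_mem_same 𝒜 hx,
    fun _ _ hj hx => DirectSum.decompose_of_mem_ne 𝒜 hx hj⟩

theorem hasProjections_freeGrading [GradedAlgebra 𝒜] : HasProjections (freeGrading 𝒜 w) := by
  refine fun m => ⟨
    { toFun := fun x i => if w i ≤ m then GradedRing.proj 𝒜 (m - w i) (x i) else 0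
      map_zero' := by ext; simp
      map_add' := fun x y => by
        ext i
        by_cases h : w i ≤ m <;> simp [h] }, fun x hx => ?_, fun j x hj hx => ?_⟩
  · ext i
    rcases hx i with h | ⟨e, he, h⟩
    · simp [h]
    · obtain rfl : e = m - w i := by omega
      simpa [show w i ≤ m by omega] using DirectSum.decompose_of_mem_same 𝒜 h
  · ext i
    rcases hx i with h | ⟨e, he, h⟩
    · simp [h]
    · by_cases hi : w i ≤ m
      · simpa [hi] using DirectSum.decompose_of_mem_ne 𝒜 h (j := m - w i) (by omega)
      · simp [hi]

/-- A linear map from a free module with homogeneous values on the generators is a graded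
surjection onto its range. -/
theorem HasProjections.isGradedSurjection_rangeRestrict [GradedAlgebra 𝒜] [Fintype ι]
    [DecidableEq ι] [SetLike.GradedSMul 𝒜 ℳ] (hℳ : HasProjections ℳ) (p : (ι → S) →ₗ[S] M)
    (hp : ∀ i, p (Pi.single i 1) ∈ ℳ (w i)) :
    IsGradedSurjection (freeGrading 𝒜 w) (subGrading ℳ (LinearMap.range p)) p.rangeRestrict := by
  refine ⟨p.surjective_rangeRestrict, fun hx => map_mem_of_mem_freeGrading p hp hx,
    fun {m y} hy => ?_⟩
  obtain ⟨π, hπ, hπ0⟩ := hℳ m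
  have key (x : ι → S) : ∃ z ∈ freeGrading 𝒜 w m, p z = π (p x) := by
    induction x using Pi.single_induction with
    | zero => exact ⟨0, zero_mem _, by simp⟩
    | add f g hf hg =>
      obtain ⟨a, ham, ha⟩ := hf
      obtain ⟨b, hbm, hb⟩ := hg
      exact ⟨a + b, add_mem ham hbm, by simp [ha, hb]⟩
    | single i s =>
      induction s using DirectSum.Decomposition.inductionOn 𝒜 with
      | zero => exact ⟨0, zero_mem _, by simp⟩
      | add s s' hs hs' =>
        obtain ⟨a, ham, ha⟩ := hs
        obtain ⟨b, hbm, hb⟩ := hs'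
        exact ⟨a + b, add_mem ham hbm, by simp [Pi.single_add, ha, hb]⟩
      | @homogeneous e s =>
        have hs : Pi.single i (s : S) ∈ freeGrading 𝒜 w (w i + e) :=
          single_mem_freeGrading s.2 rfl
        have hps := map_mem_of_mem_freeGrading p hp hs
        by_cases h : w i + e = m
        · subst h
          exact ⟨_, hs, (hπ _ hps).symm⟩
        · exact ⟨0, zero_mem _, by rw [hπ0 _ _ h hps, map_zero]⟩
  obtain ⟨x, hx⟩ := y.2
  obtain ⟨z, hzm, hz⟩ := key x
  exact ⟨z, hzm, Subtype.ext (hz.trans (by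
    rw [hx]
    exact hπ _ hy))⟩

/-- One step of a resolution by a map with homogeneous values on the generators. -/
theorem HasProjections.hasBoundedResolution_range [GradedAlgebra 𝒜] [Fintype ι]
    [DecidableEq ι] [SetLike.GradedSMul 𝒜 ℳ] (hℳ : HasProjections ℳ) (p : (ι → S) →ₗ[S] M)
    (hp : ∀ i, p (Pi.single i 1) ∈ ℳ (w i)) (hw : ∀ i, w i ≤ r)
    (hk : HasBoundedResolution 𝒜 k (r + 1) (subGrading (freeGrading 𝒜 w) (LinearMap.ker p))) :
    HasBoundedResolution 𝒜 (k + 1) r (subGrading ℳ (LinearMap.range p)) :=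
  ⟨ι, inferInstance, w, p.rangeRestrict, hw, hℳ.isGradedSurjection_rangeRestrict p hp, by
    rwa [LinearMap.ker_rangeRestrict]⟩

/-- The Mayer–Vietoris sequence of two homogeneous ideals. -/
theorem isGradedShortExact_inf_sup [GradedAlgebra 𝒜] {I J : Ideal S} (hI : I.IsHomogeneous 𝒜)
    (hJ : J.IsHomogeneous 𝒜) :
    IsGradedShortExact (idealGrading 𝒜 (I ⊓ J))
      (prodGrading (idealGrading 𝒜 I) (idealGrading 𝒜 J)) (idealGrading 𝒜 (I ⊔ J))
      ((Submodule.inclusion inf_le_left).prod (Submodule.inclusion inf_le_right))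
      ((Submodule.inclusion le_sup_left).coprod (-Submodule.inclusion le_sup_right)) := by
  refine ⟨fun x y hxy => Subtype.ext (congrArg (fun z => (z.1 : S)) hxy), fun y => ⟨fun hy => ?_, ?_⟩,
    fun {m x} => ⟨fun hx => hx.1, fun hx => ⟨hx, hx⟩⟩, fun y => ?_, fun {m x} hx => ?_,
    fun {m y} hy => ?_⟩
  · have h : (y.1 : S) = y.2 := by
      have := congrArg Subtype.val hy
      simpa [add_neg_eq_zero] using this
    exact ⟨⟨y.1, y.1.2, h ▸ y.2.2⟩, Prod.ext (Subtype.ext rfl) (Subtype.ext h)⟩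
  · rintro ⟨x, rfl⟩
    exact Subtype.ext (by simp)
  · obtain ⟨a, ha, b, hb, hab⟩ := Submodule.mem_sup.1 y.2
    exact ⟨(⟨a, ha⟩, ⟨-b, neg_mem hb⟩), Subtype.ext (by simpa using hab)⟩
  · have : (x.1 : S) + -(x.2 : S) ∈ 𝒜 m := add_mem hx.1 (neg_mem hx.2)
    simpa using this
  · obtain ⟨a, ha, b, hb, hab⟩ := Submodule.mem_sup.1 y.2
    refine ⟨(⟨GradedRing.proj 𝒜 m a, hI m ha⟩, ⟨-GradedRing.proj 𝒜 m b, neg_mem (hJ m hb)⟩),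
      ⟨?_, ?_⟩, Subtype.ext ?_⟩
    · simp
    · simp
    · have := congrArg (GradedRing.proj 𝒜 m) hab
      rw [map_add, GradedRing.proj_apply 𝒜 m (y : S),
        DirectSum.decompose_of_mem_same 𝒜 (mem_idealGrading.1 hy)] at this
      simpa using this

theorem hasBoundedResolution_bot : HasBoundedResolution 𝒜 k r (idealGrading 𝒜 (⊥ : Ideal S)) :=
  hasBoundedResolution_of_subsingleton

theorem hasBoundedResolution_span_singleton [GradedAlgebra 𝒜] [IsDomain S] {a : S} {c : ℕ}
    (ha : a ∈ 𝒜 c) (ha0 : a ≠ 0) (hc : c ≤ r) :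
    HasBoundedResolution 𝒜 k r (idealGrading 𝒜 (Ideal.span {a})) := by
  cases k with
  | zero => trivial
  | succ k =>
    let p : (Unit → S) →ₗ[S] S := LinearMap.toSpanSingleton S S a ∘ₗ LinearMap.proj ()
    have hp (x) : p x = x () * a := rfl
    have hrange : LinearMap.range p = Ideal.span {a} := by
      ext x
      rw [Ideal.mem_span_singleton']
      exact ⟨fun ⟨y, hy⟩ => ⟨y (), hy⟩, fun ⟨y, hy⟩ => ⟨fun _ => y, hy⟩⟩
    have : Subsingleton (LinearMap.ker p) := by
      refine Submodule.subsingleton_iff_eq_bot.2 (LinearMap.ker_eq_bot'.2 fun x hx => ?_)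
      ext
      simpa [hp, ha0] using hx
    rw [idealGrading, ← hrange]
    exact hasProjections_toAddSubgroup.hasBoundedResolution_range (w := fun _ => c) p
      (fun i => by simpa [hp] using ha) (fun _ => hc) hasBoundedResolution_of_subsingleton

theorem HasBoundedResolution.sup [GradedAlgebra 𝒜] {I J : Ideal S} (hI : I.IsHomogeneous 𝒜)
    (hJ : J.IsHomogeneous 𝒜) (hIk : HasBoundedResolution 𝒜 (k + 1) r (idealGrading 𝒜 I))
    (hJk : HasBoundedResolution 𝒜 (k + 1) r (idealGrading 𝒜 J))
    (hIJ : HasBoundedResolution 𝒜 k (r + 1) (idealGrading 𝒜 (I ⊓ J))) :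
    HasBoundedResolution 𝒜 (k + 1) r (idealGrading 𝒜 (I ⊔ J)) :=
  (isGradedShortExact_inf_sup hI hJ).hasBoundedResolution_right hIJ (hIk.prod hJk)

theorem HasBoundedResolution.of_sup [GradedAlgebra 𝒜] {I J : Ideal S} (hI : I.IsHomogeneous 𝒜)
    (hJ : J.IsHomogeneous 𝒜) (hk : HasBoundedResolution 𝒜 k r (idealGrading 𝒜 (I ⊔ J)))
    (hIJ : HasBoundedResolution 𝒜 k r (idealGrading 𝒜 (I ⊓ J))) :
    HasBoundedResolution 𝒜 k r (idealGrading 𝒜 I) :=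
  ((isGradedShortExact_inf_sup hI hJ).hasBoundedResolution_middle hIJ hk).fst

/-- A nonzero ideal concentrated in degrees at least `c` cannot be generated in degrees less
than `c`. -/
theorem HasBoundedResolution.le {I : Ideal S} [SetLike.GradedOne 𝒜] {c : ℕ} (hI : I ≠ ⊥)
    (hc : ∀ x ∈ I, ∀ m, x ∈ 𝒜 m → x ≠ 0 → c ≤ m)
    (h : HasBoundedResolution 𝒜 (k + 1) r (idealGrading 𝒜 I)) : c ≤ r := by
  classical
  obtain ⟨ι, _, w, p, hw, hp, -⟩ := h
  by_contra! hr
  have hp0 : p = 0 := by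
    refine LinearMap.pi_ext' fun i => LinearMap.ext_ring ?_
    by_contra hne
    have hmem := hp.map_mem (single_one_mem_freeGrading w i)
    have := hc _ (p (Pi.single i 1)).2 (w i) hmem (fun h0 => hne (Subtype.ext h0))
    exact absurd (hw i) (by omega)
  refine hI ((Submodule.eq_bot_iff _).2 fun x hx => ?_)
  obtain ⟨y, hy⟩ := hp.surjective ⟨x, hx⟩
  simpa [hp0] using (congrArg Subtype.val hy).symm

end GradedIdeals

section BoundedResolutionsOfIdeals

universe u v

/-- A submodule of a graded free module having arbitrarily long partial resolutions. -/
structure BoundedSyzygy {K : Type v} {S : Type u} [CommRing K] [CommRing S] [Algebra K S]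
    (𝒜 : ℕ → Submodule K S) (r : ℕ) where
  rank : ℕ
  deg : Fin rank → ℕ
  module : Submodule S (Fin rank → S)
  bounded : ∀ k, HasBoundedResolution 𝒜 k r (subGrading (freeGrading 𝒜 deg) module)

variable {K : Type v} {S M : Type u} [CommRing K] [CommRing S] [Algebra K S]
  [AddCommGroup M] [Module S M] {𝒜 : ℕ → Submodule K S} {ℳ : ℕ → AddSubgroup M} {r : ℕ}

theorem exists_isGradedSurjection_boundedSyzygy [SetLike.GradedMonoid 𝒜]
    (h : ∀ k, HasBoundedResolution 𝒜 k r ℳ) :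
    ∃ (Z : BoundedSyzygy 𝒜 (r + 1)) (p : (Fin Z.rank → S) →ₗ[S] M),
      (∀ i, Z.deg i ≤ r) ∧ IsGradedSurjection (freeGrading 𝒜 Z.deg) ℳ p ∧
        LinearMap.ker p = Z.module := by
  obtain ⟨ι, _, w, p, hw, hp, -⟩ := h 1
  let e := Fintype.equivFin ι
  let E : (Fin (Fintype.card ι) → S) ≃ₗ[S] (ι → S) := LinearEquiv.funCongrLeft S S e
  have hE {m x} : E x ∈ freeGrading 𝒜 w m ↔ x ∈ freeGrading 𝒜 (w ∘ e.symm) m := by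
    refine ⟨fun hx i => ?_, fun hx i => ?_⟩
    · simpa [E, LinearMap.funLeft] using hx (e.symm i)
    · simpa [E, LinearMap.funLeft] using hx (e i)
  have hpE : IsGradedSurjection (freeGrading 𝒜 (w ∘ e.symm)) ℳ (p ∘ₗ E.toLinearMap) := by
    refine ⟨hp.surjective.comp E.surjective, fun hx => hp.map_mem (hE.2 hx), fun {m y} hy => ?_⟩
    obtain ⟨x, hx, rfl⟩ := hp.exists_preimage hy
    exact ⟨E.symm x, hE.1 (by simpa using hx), by simp⟩
  exact ⟨⟨_, w ∘ e.symm, LinearMap.ker (p ∘ₗ E.toLinearMap), fun k =>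
    hpE.hasBoundedResolution_ker (fun i => hw _) (h (k + 1))⟩, _, fun i => hw _, hpE, rfl⟩

theorem BoundedSyzygy.exists_next [SetLike.GradedMonoid 𝒜] (Z : BoundedSyzygy 𝒜 r) :
    ∃ (Z' : BoundedSyzygy 𝒜 (r + 1)) (d : (Fin Z'.rank → S) →ₗ[S] (Fin Z.rank → S)),
      (∀ i, Z'.deg i ≤ r) ∧ (∀ i, d (Pi.single i 1) ∈ freeGrading 𝒜 Z.deg (Z'.deg i)) ∧
        LinearMap.range d = Z.module ∧ LinearMap.ker d = Z'.module := by
  obtain ⟨Z', p, hle, hp, hker⟩ := exists_isGradedSurjection_boundedSyzygy Z.bounded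
  refine ⟨Z', Z.module.subtype ∘ₗ p, hle,
    fun i => hp.map_mem (single_one_mem_freeGrading Z'.deg i), ?_, ?_⟩
  · rw [LinearMap.range_comp, LinearMap.range_eq_top.2 hp.surjective, Submodule.map_top,
      Submodule.range_subtype]
  · rw [LinearMap.ker_comp_of_ker_eq_bot _ Z.module.ker_subtype, hker]

attribute [local instance] MvPolynomial.gradedAlgebra

/-- Bounded graded free resolutions of an ideal exist if and only if arbitrarily long bounded
partial resolutions do. -/
theorem exists_isGradedFreeResolution_le_iff {σ K : Type*} [Field K]
    (I : Ideal (MvPolynomial σ K)) (r : ℕ) :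
    (∃ b deg aug d, IsGradedFreeResolution I b deg aug d ∧ ∀ i k, deg i k ≤ r + i) ↔
      ∀ k, HasBoundedResolution (homogeneousSubmodule σ K) k r
        (idealGrading (homogeneousSubmodule σ K) I) := by
  constructor
  · rintro ⟨b, deg, aug, d, ⟨haug, haugdeg, hd, hker, hkerd⟩, hdeg⟩ k
    have hd' (i k) : d i (Pi.single k 1) ∈
        freeGrading (homogeneousSubmodule σ K) (deg i) (deg (i + 1) k) := fun l => hd i k l
    have key (k i) : HasBoundedResolution (homogeneousSubmodule σ K) k (r + i + 1)
        (subGrading (freeGrading (homogeneousSubmodule σ K) (deg i)) (LinearMap.range (d i))) := by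
      induction k generalizing i with
      | zero => trivial
      | succ k ih =>
        refine hasProjections_freeGrading.hasBoundedResolution_range (d i) (hd' i)
          (hdeg (i + 1)) ?_
        rw [hkerd i]
        exact ih (i + 1)
    cases k with
    | zero => trivial
    | succ k =>
      rw [idealGrading, ← haug]
      refine hasProjections_toAddSubgroup.hasBoundedResolution_range aug haugdeg (hdeg 0) ?_
      rw [hker]
      exact key k 0
  · intro h
    obtain ⟨Z₀, p, hle₀, hp, hker₀⟩ := exists_isGradedSurjection_boundedSyzygy h
    choose next d hle hd hrange hker using
      fun (i : ℕ) (Z : BoundedSyzygy (homogeneousSubmodule σ K) (r + i + 1)) => Z.exists_next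
    let Z : (i : ℕ) → BoundedSyzygy (homogeneousSubmodule σ K) (r + i + 1) := fun i =>
      Nat.rec Z₀ (fun i Zi => next i Zi) i
    refine ⟨fun i => (Z i).rank, fun i => (Z i).deg, I.subtype ∘ₗ p, fun i => d i (Z i),
      ⟨?_, fun k => hp.map_mem (single_one_mem_freeGrading Z₀.deg k),
        fun i k l => hd i (Z i) k l, ?_, fun i => ?_⟩, fun i k => ?_⟩
    · rw [LinearMap.range_comp, LinearMap.range_eq_top.2 hp.surjective, Submodule.map_top,
        Submodule.range_subtype]
    · rw [LinearMap.ker_comp_of_ker_eq_bot _ (Submodule.ker_subtype I), hker₀, hrange]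
      rfl
    · rw [hker, hrange]
    · cases i with
      | zero => exact hle₀ k
      | succ i => exact hle i (Z i) k

end BoundedResolutionsOfIdeals

section VariableIdeals

variable {σ K : Type*} [Field K]

theorem isHomogeneous_prod_X (F : Finset σ) :
    (∏ i ∈ F, (X i : MvPolynomial σ K)).IsHomogeneous F.card := by
  simpa using IsHomogeneous.prod F (fun i => (X i : MvPolynomial σ K)) (fun _ => 1)
    fun i _ => isHomogeneous_X K i

theorem prod_X_ne_zero (F : Finset σ) : ∏ i ∈ F, (X i : MvPolynomial σ K) ≠ 0 :=
  Finset.prod_ne_zero_iff.2 fun i _ => X_ne_zero i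

/-- Variables outside `W` are nonzerodivisors modulo the ideal of the variables in `W`. -/
theorem mem_span_X_image_of_X_mul_mem {W : Set σ} {v : σ} (hv : v ∉ W) {f : MvPolynomial σ K}
    (h : X v * f ∈ Ideal.span (X '' W)) : f ∈ Ideal.span (X '' W) := by
  classical
  rw [mem_ideal_span_X_image] at h ⊢
  intro m hm
  obtain ⟨i, hi, him⟩ := h (Finsupp.single v 1 + m) (by
    rw [mem_support_iff, coeff_X_mul]
    exact mem_support_iff.1 hm)
  refine ⟨i, hi, ?_⟩
  have : v ≠ i := fun h => hv (h ▸ hi)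
  simpa [Finsupp.single_apply, this] using him

theorem mem_span_X_image_of_prod_X_mul_mem {W : Set σ} {F : Finset σ} (hF : ∀ v ∈ F, v ∉ W)
    {f : MvPolynomial σ K} (h : (∏ i ∈ F, X i) * f ∈ Ideal.span (X '' W)) :
    f ∈ Ideal.span (X '' W) := by
  classical
  induction F using Finset.induction_on generalizing f with
  | empty => simpa using h
  | insert v F hv ih =>
    rw [Finset.prod_insert hv, mul_assoc] at h
    exact ih (fun i hi => hF i (Finset.mem_insert_of_mem hi))
      (mem_span_X_image_of_X_mul_mem (hF v (Finset.mem_insert_self v F)) h)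

attribute [local instance] MvPolynomial.gradedAlgebra

theorem isHomogeneous_span_singleton {f : MvPolynomial σ K} {a : ℕ} (hf : f.IsHomogeneous a) :
    (Ideal.span {f}).IsHomogeneous (homogeneousSubmodule σ K) :=
  Ideal.homogeneous_span _ _ (by rintro x rfl; exact ⟨a, hf⟩)

theorem isHomogeneous_span_X_image (W : Set σ) :
    (Ideal.span (X '' W : Set (MvPolynomial σ K))).IsHomogeneous (homogeneousSubmodule σ K) :=
  Ideal.homogeneous_span _ _ (by rintro _ ⟨i, -, rfl⟩; exact ⟨1, isHomogeneous_X K i⟩)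

theorem span_singleton_mul_span_X_image_inf {f : MvPolynomial σ K} (hf : f ≠ 0) {W : Set σ}
    {v : σ} (hv : v ∉ W) :
    Ideal.span {f * X v} ⊓ Ideal.span {f} * Ideal.span (X '' W) =
      Ideal.span {f * X v} * Ideal.span (X '' W) := by
  refine le_antisymm (fun x hx => ?_) (le_inf Ideal.mul_le_left (Ideal.mul_mono_left ?_))
  · obtain ⟨hx1, hx2⟩ := hx
    obtain ⟨c, rfl⟩ := Ideal.mem_span_singleton'.1 hx1
    obtain ⟨z, hz, hzc⟩ := Ideal.mem_span_singleton_mul.1 hx2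
    obtain rfl : z = X v * c := mul_left_cancel₀ hf (by rw [hzc]; ring)
    exact Ideal.mem_span_singleton_mul.2
      ⟨c, mem_span_X_image_of_X_mul_mem hv hz, by ring⟩
  · rw [Ideal.span_singleton_le_span_singleton]
    exact dvd_mul_right _ _

/-- The product of a principal ideal and an ideal of variables has a linear resolution. -/
theorem hasBoundedResolution_span_singleton_mul_span_X_image {f : MvPolynomial σ K} {a k r : ℕ}
    (hf : f.IsHomogeneous a) (hf0 : f ≠ 0) (W : Finset σ) (hr : a + 1 ≤ r) :
    HasBoundedResolution (homogeneousSubmodule σ K) k r (idealGrading (homogeneousSubmodule σ K)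
      (Ideal.span {f} * Ideal.span (X '' (W : Set σ)))) := by
  classical
  induction W using Finset.induction_on generalizing f a k r with
  | empty =>
    rw [Finset.coe_empty, Set.image_empty, Ideal.span_empty, Ideal.mul_bot]
    exact hasBoundedResolution_bot
  | insert v W hv ih =>
    cases k with
    | zero => trivial
    | succ k =>
      have hfv : (f * X v).IsHomogeneous (a + 1) := hf.mul (isHomogeneous_X K v)
      have hfv0 : f * X v ≠ 0 := mul_ne_zero hf0 (X_ne_zero v)
      rw [Finset.coe_insert, Set.image_insert_eq, Ideal.span_insert, Ideal.mul_sup,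
        Ideal.span_singleton_mul_span_singleton]
      refine HasBoundedResolution.sup (isHomogeneous_span_singleton hfv)
        ((isHomogeneous_span_singleton hf).mul (isHomogeneous_span_X_image _))
        (hasBoundedResolution_span_singleton hfv hfv0 hr) (ih hf hf0 hr) ?_
      rw [span_singleton_mul_span_X_image_inf hf0 (by simpa using hv)]
      exact ih hfv hfv0 (by omega)

end VariableIdeals

section CircuitIdeals

variable {n d : ℕ} {K : Type*} [Field K] {C : Finset (Finset (Fin n))}

attribute [local instance] MvPolynomial.gradedAlgebra

theorem isHomogeneous_circuitIdeal (C : Finset (Finset (Fin n))) :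
    (circuitIdeal K C).IsHomogeneous (homogeneousSubmodule (Fin n) K) :=
  Ideal.homogeneous_span _ _ (by rintro _ ⟨F, -, rfl⟩; exact ⟨_, isHomogeneous_prod_X F⟩)

theorem prod_X_mem_circuitIdeal {F : Finset (Fin n)} (hF : F ∈ C) :
    ∏ i ∈ F, (X i : MvPolynomial (Fin n) K) ∈ circuitIdeal K C :=
  Ideal.subset_span ⟨F, hF, rfl⟩

theorem prod_X_mem_idealOfVars_pow (F : Finset (Fin n)) :
    ∏ i ∈ F, (X i : MvPolynomial (Fin n) K) ∈ idealOfVars (Fin n) K ^ F.card := by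
  rw [← Finset.prod_const]
  exact Ideal.prod_mem_prod fun i _ => Ideal.subset_span ⟨i, rfl⟩

theorem le_of_mem_idealOfVars_pow {σ : Type*} {f : MvPolynomial σ K} {m : ℕ}
    (h : f ∈ idealOfVars σ K ^ d) (hf : f.IsHomogeneous m) (hf0 : f ≠ 0) : d ≤ m := by
  obtain ⟨x, hx⟩ := support_nonempty.2 hf0
  have hdeg : x.degree = m := by
    by_contra hne
    exact mem_support_iff.1 hx (hf.coeff_eq_zero hne)
  exact hdeg ▸ (mem_pow_idealOfVars_iff d f).1 h x hx

theorem circuitIdeal_clutterCompl_le_idealOfVars_pow :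
    circuitIdeal K (clutterCompl d C) ≤ idealOfVars (Fin n) K ^ d := by
  rw [circuitIdeal, Ideal.span_le]
  rintro _ ⟨G, hG, rfl⟩
  have hGd : G.card = d := by
    simp only [clutterCompl, Finset.coe_sdiff, Set.mem_sdiff, Finset.mem_coe,
      Finset.mem_powersetCard_univ] at hG
    exact hG.1
  exact hGd ▸ prod_X_mem_idealOfVars_pow G

/-- An ideal generated in degree at least `d` has regularity at least `d`. -/
theorem le_of_hasBoundedResolution {I : Ideal (MvPolynomial (Fin n) K)} {r : ℕ} (hI : I ≠ ⊥)
    (hd : I ≤ idealOfVars (Fin n) K ^ d)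
    (h : HasBoundedResolution (homogeneousSubmodule (Fin n) K) 1 r
      (idealGrading (homogeneousSubmodule (Fin n) K) I)) : d ≤ r :=
  h.le hI fun _ hx _ hxm hx0 => le_of_mem_idealOfVars_pow (hd hx) hxm hx0

theorem clutterCompl_nonempty (hunif : ∀ F ∈ C, F.card = d)
    (hneq : C ≠ Finset.powersetCard d (Finset.univ : Finset (Fin n))) :
    (clutterCompl d C).Nonempty := by
  rw [clutterCompl, Finset.sdiff_nonempty]
  exact fun h => hneq (Finset.Subset.antisymm (fun F hF => by simpa using hunif F hF) h)

theorem circuitIdeal_clutterCompl_le_span_compl {F : Finset (Fin n)} (hF : F ∈ C)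
    (hFd : F.card = d) :
    circuitIdeal K (clutterCompl d C) ≤ Ideal.span (X '' ((Fᶜ : Finset (Fin n)) : Set (Fin n))) := by
  rw [circuitIdeal, Ideal.span_le]
  rintro _ ⟨G, hG, rfl⟩
  simp only [clutterCompl, Finset.coe_sdiff, Set.mem_sdiff, Finset.mem_coe,
    Finset.mem_powersetCard_univ] at hG
  have hGF : ¬ G ⊆ F := fun h => hG.2 (Finset.eq_of_subset_of_card_le h (by omega) ▸ hF)
  obtain ⟨v, hvG, hvF⟩ := Finset.not_subset.1 hGF
  exact Ideal.mem_of_dvd _ (Finset.dvd_prod_of_mem _ hvG)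
    (Ideal.subset_span ⟨v, by simpa using hvF, rfl⟩)

theorem span_prod_mul_span_compl_le_circuitIdeal {e F : Finset (Fin n)} (hcard : e.card + 1 = d)
    (heF : e ⊆ F) (huniq : ∀ G ∈ C, e ⊆ G → G = F) :
    Ideal.span {∏ i ∈ e, (X i : MvPolynomial (Fin n) K)} *
      Ideal.span (X '' ((Fᶜ : Finset (Fin n)) : Set (Fin n))) ≤
        circuitIdeal K (clutterCompl d C) := by
  rw [Ideal.span_mul_span', Ideal.span_le, Set.singleton_mul, Set.image_image]
  rintro _ ⟨v, hv, rfl⟩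
  have hvF : v ∉ F := by simpa using hv
  have hve : v ∉ e := fun h => hvF (heF h)
  have hmem : insert v e ∈ clutterCompl d C := by
    rw [clutterCompl, Finset.mem_sdiff, Finset.mem_powersetCard_univ]
    refine ⟨by rw [Finset.card_insert_of_notMem hve, hcard], fun h => hvF ?_⟩
    rw [← huniq _ h (Finset.subset_insert v e)]
    exact Finset.mem_insert_self v e
  have := prod_X_mem_circuitIdeal (K := K) hmem
  rwa [Finset.prod_insert hve, mul_comm] at this

/-- The intersection along which a circuit is glued onto the circuit ideal of the complement. -/
theorem circuitIdeal_clutterCompl_inf {e F : Finset (Fin n)} {u : Fin n} (hF : insert u e = F)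
    (hFC : F ∈ C) (hue : u ∉ e) (hcard : e.card + 1 = d) (huniq : ∀ G ∈ C, e ⊆ G → G = F) :
    circuitIdeal K (clutterCompl d C) ⊓
      (Ideal.span {∏ i ∈ e, (X i : MvPolynomial (Fin n) K)} *
        Ideal.span (X '' ((insert u Fᶜ : Finset (Fin n)) : Set (Fin n)))) =
      Ideal.span {∏ i ∈ e, (X i : MvPolynomial (Fin n) K)} *
        Ideal.span (X '' ((Fᶜ : Finset (Fin n)) : Set (Fin n))) := by
  have heF : e ⊆ F := hF ▸ Finset.subset_insert u e
  have hle := span_prod_mul_span_compl_le_circuitIdeal (K := K) hcard heF huniq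
  have hFprod : ∏ i ∈ F, (X i : MvPolynomial (Fin n) K) = (∏ i ∈ e, X i) * X u := by
    rw [← hF, Finset.prod_insert hue, mul_comm]
  refine le_antisymm (fun x ⟨hxI, hx⟩ => ?_) (le_inf hle (Ideal.mul_mono_right
    (Ideal.span_mono (Set.image_mono (by simp)))))
  rw [Finset.coe_insert, Set.image_insert_eq, Ideal.span_insert, Ideal.mul_sup,
    Ideal.span_singleton_mul_span_singleton, ← hFprod] at hx
  obtain ⟨y, hy, z, hz, rfl⟩ := Submodule.mem_sup.1 hx
  refine add_mem ?_ hz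
  obtain ⟨c, rfl⟩ := Ideal.mem_span_singleton'.1 hy
  have hc : c * ∏ i ∈ F, X i ∈ circuitIdeal K (clutterCompl d C) := by
    simpa using sub_mem hxI (hle hz)
  have hFd : F.card = d := by rw [← hF, Finset.card_insert_of_notMem hue, hcard]
  have hcF : c ∈ Ideal.span (X '' ((Fᶜ : Finset (Fin n)) : Set (Fin n))) := by
    refine mem_span_X_image_of_prod_X_mul_mem (F := F) (by simp) ?_
    rw [mul_comm]
    exact circuitIdeal_clutterCompl_le_span_compl hFC hFd hc
  rw [hFprod, show c * ((∏ i ∈ e, X i) * X u) = (∏ i ∈ e, X i) * (X u * c) by ring]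
  exact Ideal.mem_span_singleton_mul.2 ⟨_, Ideal.mul_mem_left _ _ hcF, rfl⟩

end CircuitIdeals

/-- Let `C ≠ C_{n,d}` be a `d`-uniform clutter on `[n]` and `I = I(C̄)`.
If `F ∈ C` is the only circuit of `C` containing a given submaximal circuit `e`, then
`reg I = reg (I + (x_F))`. -/
theorem reg_eq_add_unique_circuit {K : Type*} [Field K] (n d : ℕ)
    (C : Finset (Finset (Fin n))) (hunif : ∀ F ∈ C, F.card = d)
    (hneq : C ≠ Finset.powersetCard d (Finset.univ : Finset (Fin n)))
    (e F : Finset (Fin n)) (hcard : e.card = d - 1) (hF : F ∈ C) (heF : e ⊆ F)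
    (huniq : ∀ G ∈ C, e ⊆ G → G = F) :
    idealReg (circuitIdeal K (clutterCompl d C)) =
      idealReg (circuitIdeal K (clutterCompl d C) +
        Ideal.span {∏ i ∈ F, (X i : MvPolynomial (Fin n) K)}) := by
  classical
  let _ : GradedAlgebra (homogeneousSubmodule (Fin n) K) := MvPolynomial.gradedAlgebra
  have hFd := hunif F hF
  obtain ⟨G, hG⟩ := clutterCompl_nonempty hunif hneq
  have hGd : G.card = d := by
    rw [clutterCompl, Finset.mem_sdiff, Finset.mem_powersetCard_univ] at hG
    exact hG.1
  have hd : e.card + 1 = d := by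
    rcases Nat.eq_zero_or_pos d with rfl | hpos
    · rw [Finset.card_eq_zero] at hFd hGd
      rw [clutterCompl, Finset.mem_sdiff, hGd, ← hFd] at hG
      exact absurd hF hG.2
    · omega
  obtain ⟨u, hue, hu⟩ : ∃ u ∉ e, insert u e = F :=
    (Finset.covBy_iff_exists_insert).1 (Finset.covBy_iff_card_sdiff_eq_one.2
      ⟨heF, by rw [Finset.card_sdiff_of_subset heF]; omega⟩)
  set I := circuitIdeal K (clutterCompl d C) with hI
  set a : MvPolynomial (Fin n) K := ∏ i ∈ e, X i with ha
  have ha' : a.IsHomogeneous e.card := isHomogeneous_prod_X e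
  have ha0 : a ≠ 0 := prod_X_ne_zero e
  set L := Ideal.span {a} * Ideal.span (X '' ((insert u Fᶜ : Finset (Fin n)) : Set (Fin n)))
    with hL
  have hinf : I ⊓ L = Ideal.span {a} * Ideal.span (X '' ((Fᶜ : Finset (Fin n)) : Set (Fin n))) :=
    circuitIdeal_clutterCompl_inf hu hF hue hd huniq
  have hsup : I + Ideal.span {∏ i ∈ F, (X i : MvPolynomial (Fin n) K)} = I ⊔ L := by
    have hFprod : ∏ i ∈ F, (X i : MvPolynomial (Fin n) K) = a * X u := by
      rw [← hu, Finset.prod_insert hue, mul_comm]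
    rw [hL, Finset.coe_insert, Set.image_insert_eq, Ideal.span_insert, Ideal.mul_sup,
      Ideal.span_singleton_mul_span_singleton, ← hFprod, Submodule.add_eq_sup, sup_comm
        (Ideal.span {∏ i ∈ F, (X i : MvPolynomial (Fin n) K)}), ← sup_assoc,
      sup_eq_left.2 (hinf.symm.le.trans inf_le_left)]
  have hIhom := isHomogeneous_circuitIdeal (K := K) (clutterCompl d C)
  have hLhom : L.IsHomogeneous (homogeneousSubmodule (Fin n) K) :=
    (isHomogeneous_span_singleton ha').mul (isHomogeneous_span_X_image _)
  have hIle : I ≤ idealOfVars (Fin n) K ^ d := circuitIdeal_clutterCompl_le_idealOfVars_pow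
  have hI0 : I ≠ ⊥ := fun h => prod_X_ne_zero G ((Submodule.eq_bot_iff _).1 h _
    (prod_X_mem_circuitIdeal hG))
  have hIL0 : I ⊔ L ≠ ⊥ := fun h => hI0 (le_bot_iff.1 (h ▸ le_sup_left))
  have hILle : I ⊔ L ≤ idealOfVars (Fin n) K ^ d := by
    rw [← hsup]
    refine sup_le hIle ((Ideal.span_singleton_le_iff_mem _).2 ?_)
    exact hFd ▸ prod_X_mem_idealOfVars_pow F
  have hlin (W : Finset (Fin n)) (k r : ℕ) (hr : d ≤ r) :=
    hasBoundedResolution_span_singleton_mul_span_X_image (k := k) (r := r) ha' ha0 W (by omega)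
  rw [hsup, idealReg, idealReg]
  congr 1
  ext r
  rw [Set.mem_ofPred_eq, Set.mem_ofPred_eq, exists_isGradedFreeResolution_le_iff,
    exists_isGradedFreeResolution_le_iff]
  refine ⟨fun h k => ?_, fun h k => ?_⟩
  · have hr : d ≤ r := le_of_hasBoundedResolution hI0 hIle (h 1)
    cases k with
    | zero => trivial
    | succ k => exact (h (k + 1)).sup hIhom hLhom (hlin _ _ r hr) (hinf ▸ hlin _ _ _ (by omega))
  · have hr : d ≤ r := le_of_hasBoundedResolution hIL0 hILle (h 1)
    exact (h k).of_sup hIhom hLhom (hinf ▸ hlin _ _ r hr)
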